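/- Let p be a prime and let G be a finitely generated nilpotent group. Then G is conjugacy F_p-separable if and only if its torsion subgroup τ(G) is a p-group and the quotient group G/τ(G) is abelian. -/

import Mathlib

/-- `G` is conjugacy `F_p`-separable: whenever `a, b ∈ G` are not conjugate in `G`,
there exists a surjective homomorphism `φ` of `G` onto some finite `p`-group `X`
such that `φ a` and `φ b` are not conjugate in `X`. -/
def IsConjFpSeparable (p : ℕ) (G : Type) [Group G] : Prop :=
  ∀ a b : G, ¬ IsConj a b →
    ∃ (X : Type) (_ : Group X) (_ : Fintype X),
      IsPGroup p X ∧
      ∃ φ : G →* X, Function.Surjective φ ∧ ¬ IsConj (φ a) (φ b)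

open Subgroup
open scoped commutatorElement IsMulCommutative

universe u

theorem CommGroup.isOfFinOrder_of_forall_exists_pow_eq {A : Type*} [CommGroup A] [Group.FG A]
    {q : ℕ} (hq : q.Prime) {h : A} (hh : ∀ k : ℕ, ∃ c : A, c ^ q ^ k = h) : IsOfFinOrder h := by
  have : AddGroup.FG (Additive A) := inferInstance
  have : Module.Finite ℤ (Additive A) := Module.Finite.iff_addGroup_fg.mpr this
  have hmem : Additive.ofMul h ∈
      (⨅ i : ℕ, (Ideal.span {(q : ℤ)}) ^ i • ⊤ : Submodule ℤ (Additive A)) := by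
    rw [Submodule.mem_iInf]
    intro k
    obtain ⟨c, rfl⟩ := hh k
    have hc : Additive.ofMul (c ^ q ^ k) = ((q : ℤ) ^ k) • Additive.ofMul c := by
      rw [ofMul_pow, ← natCast_zsmul]; push_cast; rfl
    rw [hc]
    exact Submodule.smul_mem_smul (Ideal.pow_mem_pow (Ideal.mem_span_singleton_self _) k) trivial
  obtain ⟨⟨r, hr⟩, hrh⟩ := (Ideal.mem_iInf_smul_pow_eq_bot_iff _ _).mp hmem
  have hr1 : r - 1 ≠ 0 := by
    intro h0
    rw [Ideal.mem_span_singleton, sub_eq_zero.mp h0] at hr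
    exact hq.one_lt.ne' (by exact_mod_cast Int.eq_one_of_dvd_one (by positivity) hr)
  refine isOfFinOrder_iff_zpow_eq_one.mpr ⟨r - 1, hr1, ?_⟩
  apply Additive.ofMul.injective
  rw [ofMul_zpow, sub_smul, one_smul, ofMul_one, sub_eq_zero]
  exact hrh

theorem CommGroup.fg_subgroup {A : Type*} [CommGroup A] [Group.FG A] (H : Subgroup A) :
    Group.FG H := by
  have : Module.Finite ℤ (Additive A) := Module.Finite.iff_addGroup_fg.mpr inferInstance
  rw [Group.fg_iff_subgroup_fg, Subgroup.fg_iff_add_fg,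
    ← AddSubgroup.toIntSubmodule_toAddSubgroup H.toAddSubgroup, ← Submodule.fg_iff_addSubgroup_fg]
  exact IsNoetherian.noetherian _

theorem Group.finite_of_fg_of_isSolvable_of_isOfFinOrder {G : Type*} [Group G] [Group.FG G]
    [Group.IsSolvable G] (h : ∀ g : G, IsOfFinOrder g) : Finite G := by
  have key : ∀ n : ℕ, (derivedSeries G n).FiniteIndex := by
    intro n
    induction n with
    | zero => rw [derivedSeries_zero]; infer_instance
    | succ n ih =>
      have hfg : Group.FG (Abelianization (derivedSeries G n)) :=
        QuotientGroup.fg (_root_.commutator (derivedSeries G n))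
      have hfin : Finite (Abelianization (derivedSeries G n)) :=
        CommGroup.finite_of_fg_isMulTorsion _ <|
          (IsMulTorsion.subgroup h _).of_surjective (f := Abelianization.of)
            QuotientGroup.mk_surjective
      have hidx : (_root_.commutator (derivedSeries G n)).FiniteIndex :=
        @Subgroup.finiteIndex_of_finite_quotient _ _ _ hfin
      rw [derivedSeries_succ, ← Subgroup.map_subtype_commutator]
      exact ⟨by
        rw [Subgroup.index_map_subtype]
        exact mul_ne_zero hidx.index_ne_zero ih.index_ne_zero⟩
  obtain ⟨n, hn⟩ := (Group.isSolvable_def G).mp ‹_›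
  have hbot := key n
  rw [hn] at hbot
  exact Subgroup.finite_quotient_of_finiteIndex.of_equiv _
    (QuotientGroup.quotientBot (G := G)).toEquiv

theorem commutatorElement_pow_left {G : Type*} [Group G] {x g : G}
    (h : ∀ y, Commute ⁅x, g⁆ y) (n : ℕ) : ⁅x ^ n, g⁆ = ⁅x, g⁆ ^ n := by
  induction n with
  | zero => simp
  | succ n ih =>
    have hsucc : ⁅x ^ (n + 1), g⁆ = x ^ n * ⁅x, g⁆ * (x ^ n)⁻¹ * ⁅x ^ n, g⁆ := by
      simp only [commutatorElement_def, pow_succ]; group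
    rw [hsucc, ih, ← (h (x ^ n)).eq, mul_inv_cancel_right, pow_succ']

theorem commutatorElement_pow_right {G : Type*} [Group G] {x g : G}
    (h : ∀ y, Commute ⁅x, g⁆ y) (n : ℕ) : ⁅x, g ^ n⁆ = ⁅x, g⁆ ^ n := by
  have hc : ∀ y, Commute ⁅g, x⁆ y := fun y ↦ by
    rw [← commutatorElement_inv x g]; exact (h y).inv_left
  rw [← commutatorElement_inv, commutatorElement_pow_left hc, ← inv_pow, commutatorElement_inv]

theorem Subgroup.exists_pow_mem_upperCentralSeries {G : Type*} [Group G] [Group.FG G]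
    (h : ∀ x ∈ upperCentralSeries G 2, ∀ g : G, IsOfFinOrder ⁅x, g⁆) (n : ℕ) :
    ∀ x ∈ upperCentralSeries G (n + 2), ∃ k, 0 < k ∧ x ^ k ∈ upperCentralSeries G (n + 1) := by
  have step (m : ℕ) (x : G) (hx : x ∈ upperCentralSeries G (m + 2))
      (hpow : ∀ g : G, ∃ k, 0 < k ∧ ⁅x, g⁆ ^ k ∈ upperCentralSeries G m) :
      ∃ k, 0 < k ∧ x ^ k ∈ upperCentralSeries G (m + 1) := by
    obtain ⟨S, hS⟩ := Group.FG.out (G := G)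
    choose k hk hkmem using hpow
    refine ⟨∏ s ∈ S, k s, Finset.prod_pos fun s _ ↦ hk s, ?_⟩
    let N := upperCentralSeries G m
    have hN : N.Normal := inferInstanceAs (upperCentralSeries G m).Normal
    have hcomm (g : G) (j : ℕ) : ((⁅x ^ j, g⁆ : G) : G ⧸ N) = ((⁅x, g⁆ ^ j : G) : G ⧸ N) := by
      have hc : ∀ y, Commute ⁅(x : G ⧸ N), (g : G ⧸ N)⁆ y := by
        intro y
        induction y using QuotientGroup.induction_on with
        | H y =>
          rw [← commutatorElement_eq_one_iff_commute]
          exact (QuotientGroup.eq_one_iff (N := N) ⁅⁅x, g⁆, y⁆).mpr (hx g y)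
      exact commutatorElement_pow_left hc j
    have hcent : Subgroup.closure (S : Set G) ≤
        (Subgroup.centralizer {((x ^ ∏ s ∈ S, k s : G) : G ⧸ N)}).comap (QuotientGroup.mk' N) := by
      rw [Subgroup.closure_le]
      intro s hs
      rw [SetLike.mem_coe, Subgroup.mem_comap, Subgroup.mem_centralizer_singleton_iff]
      refine Eq.symm (commutatorElement_eq_one_iff_mul_comm.mp ?_)
      refine (hcomm s _).trans ((QuotientGroup.eq_one_iff _).mpr ?_)
      obtain ⟨c, hc⟩ := Finset.dvd_prod_of_mem k hs
      rw [hc, pow_mul]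
      exact N.pow_mem (hkmem s) c
    rw [hS] at hcent
    intro g
    have hg := hcent (Subgroup.mem_top g)
    rw [Subgroup.mem_comap, Subgroup.mem_centralizer_singleton_iff] at hg
    exact (QuotientGroup.eq_one_iff (N := N) ⁅_, g⁆).mp
      (commutatorElement_eq_one_iff_mul_comm.mpr hg.symm)
  induction n with
  | zero =>
    refine fun x hx ↦ step 0 x hx fun g ↦ ?_
    obtain ⟨k, hk, hk1⟩ := isOfFinOrder_iff_pow_eq_one.mp (h x hx g)
    exact ⟨k, hk, by rw [hk1]; exact one_mem _⟩
  | succ n ih => exact fun x hx ↦ step (n + 1) x hx fun g ↦ ih _ (hx g)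

theorem Subgroup.exists_pow_mem_center {G : Type*} [Group G] [Group.FG G] [Group.IsNilpotent G]
    (h : ∀ x ∈ upperCentralSeries G 2, ∀ g : G, IsOfFinOrder ⁅x, g⁆) (x : G) :
    ∃ k, 0 < k ∧ x ^ k ∈ center G := by
  have key (n : ℕ) : ∀ x ∈ upperCentralSeries G (n + 1), ∃ k, 0 < k ∧ x ^ k ∈ center G := by
    induction n with
    | zero =>
      intro x hx
      rw [zero_add, upperCentralSeries_one] at hx
      exact ⟨1, one_pos, by simpa using hx⟩
    | succ n ih =>
      intro x hx
      obtain ⟨k, hk, hxk⟩ := exists_pow_mem_upperCentralSeries h n x hx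
      obtain ⟨l, hl, hxl⟩ := ih _ hxk
      exact ⟨k * l, Nat.mul_pos hk hl, by rwa [pow_mul]⟩
  obtain ⟨n, hn⟩ := Group.IsNilpotent.nilpotent' (G := G)
  exact key n x (upperCentralSeries_mono G n.le_succ (hn ▸ mem_top x))

theorem Subgroup.finiteIndex_center_of_isOfFinOrder {G : Type*} [Group G] [Group.FG G]
    [Group.IsNilpotent G]
    (h : ∀ x ∈ upperCentralSeries G 2, ∀ g : G, IsOfFinOrder ⁅x, g⁆) :
    (center G).FiniteIndex := by
  have : Finite (G ⧸ center G) := by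
    refine Group.finite_of_fg_of_isSolvable_of_isOfFinOrder fun g ↦ ?_
    induction g using QuotientGroup.induction_on with
    | H g =>
      obtain ⟨k, hk, hgk⟩ := exists_pow_mem_center h g
      exact isOfFinOrder_iff_pow_eq_one.mpr ⟨k, hk, (QuotientGroup.eq_one_iff _).mpr hgk⟩
  exact Subgroup.finiteIndex_of_finite_quotient

theorem Subgroup.finite_commutatorSet_of_finiteIndex_center {G : Type*} [Group G]
    [(center G).FiniteIndex] : Finite (commutatorSet G) := by
  let f : (G ⧸ center G) × (G ⧸ center G) → G := fun q ↦ ⁅q.1.out, q.2.out⁆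
  have hfin : (Set.range f).Finite := Set.finite_range f
  refine (hfin.subset ?_).to_subtype
  rintro _ ⟨x, y, rfl⟩
  refine ⟨(x, y), ?_⟩
  obtain ⟨⟨u, hu⟩, hxu⟩ := QuotientGroup.mk_out_eq_mul (center G) x
  obtain ⟨⟨v, hv⟩, hyv⟩ := QuotientGroup.mk_out_eq_mul (center G) y
  rw [mem_center_iff] at hu hv
  calc f (x, y) = x * (u * (y * v) * u⁻¹) * x⁻¹ * v⁻¹ * y⁻¹ := by
        simp only [f, hxu, hyv, commutatorElement_def]; group
    _ = x * y * (v * x⁻¹) * v⁻¹ * y⁻¹ := by rw [← hu]; group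
    _ = ⁅x, y⁆ := by rw [← hv, commutatorElement_def]; group

/-- The homomorphism `g ↦ ⁅x, g⁆` to the center, for `x` in the second center. -/
def Subgroup.commutatorHom {G : Type*} [Group G] (x : G) (hx : x ∈ upperCentralSeries G 2) :
    G →* center G :=
  MonoidHom.mk' (fun g ↦ ⟨⁅x, g⁆, upperCentralSeries_one G ▸ hx g⟩) fun g h ↦ by
    have hc : ⁅x, h⁆ ∈ center G := upperCentralSeries_one G ▸ hx h
    rw [mem_center_iff] at hc
    ext
    calc ⁅x, g * h⁆ = ⁅x, g⁆ * (g * ⁅x, h⁆ * g⁻¹) := by simp only [commutatorElement_def]; group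
      _ = ⁅x, g⁆ * ⁅x, h⁆ := by rw [hc, mul_inv_cancel_right]

theorem IsConjFpSeparable.exists_commutatorElement_pow_eq {p : ℕ} [Fact p.Prime] {G : Type}
    [Group G] (hG : IsConjFpSeparable p G) {q : ℕ} (hpq : p.Coprime q) {x : G}
    (hx : x ∈ Subgroup.upperCentralSeries G 2) (y : G) : ∃ g, ⁅x, g⁆ ^ q = ⁅x, y⁆ := by
  have hcent (g h : G) : Commute ⁅x, g⁆ h := by
    have hc : ⁅x, g⁆ ∈ center G := Subgroup.upperCentralSeries_one G ▸ hx g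
    exact (mem_center_iff.mp hc h).symm
  by_contra! hne
  obtain ⟨X, _, _, hX, φ, hφ, hconj⟩ := hG (x ^ q) (⁅x, y⁆⁻¹ * x ^ q) fun hc ↦ by
    obtain ⟨c, hc⟩ := isConj_iff.mp hc
    refine hne c ?_
    rw [← commutatorElement_pow_left (hcent c), ← inv_inj, commutatorElement_inv,
      commutatorElement_def, hc, mul_inv_cancel_right]
  refine hconj (isConj_iff.mpr ?_)
  obtain ⟨m, hm⟩ := IsPGroup.iff_card.mp hX
  obtain ⟨d, hd⟩ := (powCoprime (G := X) (n := q) (hm ▸ hpq.pow_left m)).surjective (φ y)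
  obtain ⟨w, rfl⟩ := hφ d
  refine ⟨φ w, ?_⟩
  have hd' : φ w ^ q = φ y := hd
  have hw : φ ⁅x ^ q, w⁆ = φ ⁅x, y⁆ := by
    rw [commutatorElement_pow_left (hcent w), ← commutatorElement_pow_right (hcent w),
      map_commutatorElement, map_commutatorElement, map_pow, hd']
  rw [map_mul, map_inv, ← hw, map_commutatorElement, commutatorElement_inv, commutatorElement_def,
    inv_mul_cancel_right]

theorem IsConjFpSeparable.isOfFinOrder_commutatorElement {p : ℕ} [Fact p.Prime] {G : Type}
    [Group G] [Group.FG G] (hG : IsConjFpSeparable p G) {x : G}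
    (hx : x ∈ Subgroup.upperCentralSeries G 2) (y : G) : IsOfFinOrder ⁅x, y⁆ := by
  obtain ⟨q, hpq, hq⟩ := Nat.exists_infinite_primes (p + 1)
  have hcop : p.Coprime q := (Nat.coprime_primes Fact.out hq).mpr (by omega)
  let f := commutatorHom x hx
  have hroot (k : ℕ) : ∃ c : f.range, c ^ q ^ k = f.rangeRestrict y := by
    suffices ∃ g, ⁅x, g⁆ ^ q ^ k = ⁅x, y⁆ by
      obtain ⟨g, hg⟩ := this
      exact ⟨f.rangeRestrict g, Subtype.ext (Subtype.ext hg)⟩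
    induction k with
    | zero => exact ⟨y, by simp⟩
    | succ k ih =>
      obtain ⟨g, hg⟩ := ih
      obtain ⟨g', hg'⟩ := hG.exists_commutatorElement_pow_eq hcop hx g
      exact ⟨g', by rw [pow_succ', pow_mul, hg', hg]⟩
  have hfg : Group.FG f.range := Group.fg_range f
  have hfin := CommGroup.isOfFinOrder_of_forall_exists_pow_eq hq hroot
  exact ((center G).subtype.comp f.range.subtype).isOfFinOrder hfin

theorem IsConjFpSeparable.exists_pow_eq_one {p : ℕ} [Fact p.Prime] {G : Type} [Group G]
    (hG : IsConjFpSeparable p G) {g : G} (hg : IsOfFinOrder g) : ∃ k, g ^ p ^ k = 1 := by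
  obtain ⟨k, m, hm, hkm⟩ := Nat.exists_eq_pow_mul_and_not_dvd hg.orderOf_pos.ne' p
    (Fact.out : p.Prime).ne_one
  refine ⟨k, by_contra fun hne ↦ ?_⟩
  obtain ⟨X, _, _, hX, φ, -, hconj⟩ := hG (g ^ p ^ k) 1 (by simpa using hne)
  rw [map_one, isConj_one_left] at hconj
  obtain ⟨j, hj⟩ := hX (φ (g ^ p ^ k))
  have hm1 : φ (g ^ p ^ k) ^ m = 1 := by
    rw [← map_pow, ← pow_mul, ← hkm, pow_orderOf_eq_one, map_one]
  refine hconj (orderOf_eq_one_iff.mp (Nat.dvd_one.mp ?_))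
  have hcop : (p ^ j).Coprime m := ((Nat.Prime.coprime_iff_not_dvd Fact.out).mpr hm).pow_left j
  rw [← hcop.gcd_eq_one]
  exact Nat.dvd_gcd (orderOf_dvd_of_pow_eq_one hj) (orderOf_dvd_of_pow_eq_one hm1)

theorem Group.IsNilpotent.exists_hom_isPGroup (p : ℕ) [Fact p.Prime] (Q : Type u) [Group Q]
    [Finite Q] [Group.IsNilpotent Q] :
    ∃ (Y : Type u) (_ : Group Y) (_ : Finite Y), IsPGroup p Y ∧
      ∃ π : Q →* Y, ∀ g : Q, (∃ k, g ^ p ^ k = 1) → π g = 1 → g = 1 := by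
  obtain ⟨e⟩ := (Group.isNilpotent_of_finite_tfae (G := Q)).out 0 4 |>.mp ‹_›
  by_cases hp : p ∈ (Nat.card Q).primeFactors
  · refine ⟨∀ P : Sylow p Q, P, inferInstance, inferInstance, ?_,
      (Pi.evalMonoidHom (fun q : (Nat.card Q).primeFactors ↦ ∀ P : Sylow q Q, P) ⟨p, hp⟩).comp
        e.symm.toMonoidHom, ?_⟩
    · intro f
      choose k hk using fun P : Sylow p Q ↦ P.isPGroup' (f P)
      have : Fintype (Sylow p Q) := Fintype.ofFinite _
      refine ⟨∑ P, k P, funext fun P ↦ ?_⟩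
      obtain ⟨c, hc⟩ := pow_dvd_pow p (Finset.single_le_sum (f := k) (fun _ _ ↦ Nat.zero_le _)
        (Finset.mem_univ P))
      rw [Pi.pow_apply, hc, pow_mul, hk, one_pow, Pi.one_apply]
    · rintro g ⟨k, hk⟩ hg
      refine (map_eq_one_iff e.symm e.symm.injective).mp (funext fun ⟨q, hq⟩ ↦ ?_)
      by_cases hqp : q = p
      · subst hqp; exact hg
      · funext P
        have : Fact q.Prime := ⟨Nat.prime_of_mem_primeFactors hq⟩
        have hpow : (e.symm g ⟨q, hq⟩ P) ^ p ^ k = 1 := by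
          have := congrFun (congrFun (congrArg e.symm hk) ⟨q, hq⟩) P
          rw [map_pow, map_one] at this
          exact this
        obtain ⟨j, hj⟩ := P.isPGroup' (e.symm g ⟨q, hq⟩ P)
        have hcop : (p ^ k).Coprime (q ^ j) :=
          Nat.Coprime.pow k j ((Nat.coprime_primes Fact.out Fact.out).mpr (Ne.symm hqp))
        refine orderOf_eq_one_iff.mp (Nat.dvd_one.mp ?_)
        rw [← hcop.gcd_eq_one]
        exact Nat.dvd_gcd (orderOf_dvd_of_pow_eq_one hpow) (orderOf_dvd_of_pow_eq_one hj)
  · refine ⟨PUnit, inferInstance, inferInstance, fun _ ↦ ⟨0, rfl⟩, 1, ?_⟩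
    rintro g ⟨k, hk⟩ -
    have hcop : (p ^ k).Coprime (Nat.card Q) := by
      refine ((Nat.Prime.coprime_iff_not_dvd Fact.out).mpr fun hd ↦ hp ?_).pow_left k
      exact Nat.mem_primeFactors.mpr ⟨Fact.out, hd, Nat.card_pos.ne'⟩
    refine orderOf_eq_one_iff.mp (Nat.dvd_one.mp ?_)
    rw [← hcop.gcd_eq_one]
    exact Nat.dvd_gcd (orderOf_dvd_of_pow_eq_one hk) (orderOf_dvd_natCard g)

theorem exists_surjective_not_isConj_of_hom {p : ℕ} {G Y : Type} [Group G] [Group Y] [Finite Y]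
    (hY : IsPGroup p Y) (φ : G →* Y) {a b : G} (h : ∀ g, φ (g * a * g⁻¹) ≠ φ b) :
    ∃ (X : Type) (_ : Group X) (_ : Fintype X), IsPGroup p X ∧
      ∃ φ : G →* X, Function.Surjective φ ∧ ¬ IsConj (φ a) (φ b) := by
  refine ⟨φ.range, inferInstance, Fintype.ofFinite _, hY.to_subgroup _, φ.rangeRestrict,
    φ.rangeRestrict_surjective, fun hc ↦ ?_⟩
  obtain ⟨c, hc⟩ := isConj_iff.mp hc
  obtain ⟨g, rfl⟩ := φ.rangeRestrict_surjective c
  refine h g ?_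
  rw [← map_inv, ← map_mul, ← map_mul] at hc
  exact congrArg Subtype.val hc

theorem CommGroup.exists_isPGroup_quotient_notMem {p : ℕ} [Fact p.Prime] {A : Type*} [CommGroup A]
    [Group.FG A] {h : A} (hh : ¬ IsOfFinOrder h) :
    ∃ N : Subgroup A, Finite (A ⧸ N) ∧ IsPGroup p (A ⧸ N) ∧ h ∉ N := by
  have hroot := mt (isOfFinOrder_of_forall_exists_pow_eq (Fact.out : p.Prime)) hh
  push Not at hroot
  obtain ⟨k, hk⟩ := hroot
  have hpow (g : A ⧸ (powMonoidHom (p ^ k) : A →* A).range) : g ^ p ^ k = 1 := by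
    induction g using QuotientGroup.induction_on with
    | H g => exact (QuotientGroup.eq_one_iff _).mpr ⟨g, rfl⟩
  refine ⟨(powMonoidHom (p ^ k) : A →* A).range, ?_, fun g ↦ ⟨k, hpow g⟩, fun ⟨c, hc⟩ ↦ hk c hc⟩
  exact CommGroup.finite_of_fg_isMulTorsion _ fun g ↦
    isOfFinOrder_iff_pow_eq_one.mpr ⟨_, pow_pos (Fact.out : p.Prime).pos k, hpow g⟩

theorem exists_hom_isPGroup_injOn_torsion {p : ℕ} [Fact p.Prime] {G : Type u} [Group G]
    [Group.FG G] [Group.IsNilpotent G] [(center G).FiniteIndex]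
    (hG : ∀ g : G, IsOfFinOrder g → ∃ k, g ^ p ^ k = 1) :
    ∃ (Y : Type u) (_ : Group Y) (_ : Finite Y), IsPGroup p Y ∧
      ∃ φ : G →* Y, ∀ g, IsOfFinOrder g → φ g = 1 → g = 1 := by
  have hfg : Group.FG (CommGroup.torsion (center G)) := CommGroup.fg_subgroup _
  have hfin : Finite (CommGroup.torsion (center G)) :=
    CommGroup.finite_of_fg_isMulTorsion _ fun z ↦ Submonoid.isOfFinOrder_coe.mp z.2
  have hpG : IsPGroup p (CommGroup.torsion (center G)) := fun z ↦ by
    obtain ⟨k, hk⟩ := hG z (Submonoid.isOfFinOrder_coe.mpr z.2)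
    exact ⟨k, Subtype.ext (Subtype.ext hk)⟩
  obtain ⟨m, hm⟩ := IsPGroup.iff_card.mp hpG
  let N : Subgroup G := (powMonoidHom (p ^ m) : center G →* center G).range.map (center G).subtype
  have hN {g : G} : g ∈ N ↔ ∃ z ∈ center G, z ^ p ^ m = g := by
    constructor
    · rintro ⟨_, ⟨z, rfl⟩, rfl⟩
      exact ⟨z, z.2, rfl⟩
    · rintro ⟨z, hz, rfl⟩
      exact ⟨_, ⟨⟨z, hz⟩, rfl⟩, rfl⟩
  have hNnormal : N.Normal := ⟨fun n hn g ↦ by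
    obtain ⟨z, hz, rfl⟩ := hN.mp hn
    rwa [mem_center_iff.mp (pow_mem hz _) g, mul_inv_cancel_right]⟩
  have hpm : 0 < p ^ m := pow_pos (Fact.out : p.Prime).pos m
  have hquot : Finite (G ⧸ N) := by
    refine Group.finite_of_fg_of_isSolvable_of_isOfFinOrder fun g ↦ ?_
    induction g using QuotientGroup.induction_on with
    | H g =>
      refine isOfFinOrder_iff_pow_eq_one.mpr ⟨(center G).index * p ^ m,
        Nat.mul_pos (Nat.pos_of_ne_zero FiniteIndex.index_ne_zero) hpm,
        (QuotientGroup.eq_one_iff _).mpr (hN.mpr ⟨_, pow_index_mem (center G) g, ?_⟩)⟩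
      exact (pow_mul g _ _).symm
  obtain ⟨Y, _, _, hY, π, hπ⟩ := Group.IsNilpotent.exists_hom_isPGroup p (G ⧸ N)
  refine ⟨Y, _, ‹_›, hY, π.comp (QuotientGroup.mk' N), fun g hg hg1 ↦ ?_⟩
  obtain ⟨k, hk⟩ := hG g hg
  have hkN : g ^ p ^ k ∈ N := hk ▸ one_mem N
  have hgN : g ∈ N := (QuotientGroup.eq_one_iff g).mp <|
    hπ g ⟨k, (QuotientGroup.eq_one_iff _).mpr hkN⟩ hg1
  obtain ⟨z, hz, rfl⟩ := hN.mp hgN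
  have hzfin : IsOfFinOrder z := hg.of_pow hpm.ne'
  have hz' := pow_card_eq_one' (x := (⟨⟨z, hz⟩, Submonoid.isOfFinOrder_coe.mp hzfin⟩ :
    CommGroup.torsion (center G)))
  rw [hm] at hz'
  exact congrArg (fun t : CommGroup.torsion (center G) ↦ ((t : center G) : G)) hz'

/-- Let `p` be a prime and `G` a finitely generated nilpotent group, with torsion
subgroup `τ` (the subgroup of all elements of finite order). Then `G` is conjugacy
`F_p`-separable iff `τ` is a `p`-group and `G ⧸ τ` is abelian. -/
theorem conjFpSeparable_iff_of_nilpotent_fg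
    (p : ℕ) (hp : p.Prime) (G : Type) [Group G] [Group.FG G] [Group.IsNilpotent G]
    (τ : Subgroup G) [τ.Normal] (hτ : ∀ g : G, g ∈ τ ↔ IsOfFinOrder g) :
    IsConjFpSeparable p G ↔
      (IsPGroup p τ ∧ ∀ x y : G ⧸ τ, x * y = y * x) := by
  have : Fact p.Prime := ⟨hp⟩
  constructor
  · intro hG
    refine ⟨fun g ↦ ?_, fun x y ↦ ?_⟩
    · obtain ⟨k, hk⟩ := hG.exists_pow_eq_one ((hτ g).mp g.2)
      exact ⟨k, Subtype.ext hk⟩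
    · have := finiteIndex_center_of_isOfFinOrder fun x hx y ↦
        hG.isOfFinOrder_commutatorElement hx y
      have := finite_commutatorSet_of_finiteIndex_center (G := G)
      induction x using QuotientGroup.induction_on with
      | H x =>
        induction y using QuotientGroup.induction_on with
        | H y =>
          rw [← commutatorElement_eq_one_iff_mul_comm]
          refine (QuotientGroup.eq_one_iff ⁅x, y⁆).mpr ((hτ _).mpr ?_)
          exact (commutator G).subtype.isOfFinOrder (isOfFinOrder_of_finite
            (⟨⁅x, y⁆, commutator_mem_commutator (mem_top x) (mem_top y)⟩ : commutator G))
  · rintro ⟨hpG, hab⟩ a b hconj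
    by_cases hmem : a⁻¹ * b ∈ τ
    · have := finiteIndex_center_of_isOfFinOrder (G := G) fun x _ y ↦ (hτ _).mp <|
        (QuotientGroup.eq_one_iff ⁅x, y⁆).mp (commutatorElement_eq_one_iff_mul_comm.mpr (hab x y))
      obtain ⟨Y, _, _, hY, φ, hφ⟩ := exists_hom_isPGroup_injOn_torsion (p := p) (G := G)
        fun g hg ↦ by
          obtain ⟨k, hk⟩ := hpG ⟨g, (hτ g).mpr hg⟩
          exact ⟨k, congrArg Subtype.val hk⟩
      refine exists_surjective_not_isConj_of_hom hY φ fun g hg ↦ hconj (isConj_iff.mpr ⟨g, ?_⟩)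
      refine inv_mul_eq_one.mp (hφ _ ((hτ _).mp ?_) (by rw [map_mul, map_inv, hg, inv_mul_cancel]))
      rw [← QuotientGroup.eq] at hmem ⊢
      rw [← hmem, QuotientGroup.mk_mul, hab, QuotientGroup.mk_mul, QuotientGroup.mk_inv,
        inv_mul_cancel_left]
    · let : CommGroup (G ⧸ τ) := { (inferInstance : Group (G ⧸ τ)) with mul_comm := hab }
      have hinf : ¬ IsOfFinOrder ((a⁻¹ * b : G) : G ⧸ τ) := fun hfin ↦ hmem <| by
        obtain ⟨n, hn, hn1⟩ := isOfFinOrder_iff_pow_eq_one.mp hfin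
        have hn2 := (hτ _).mp ((QuotientGroup.eq_one_iff ((a⁻¹ * b) ^ n)).mp hn1)
        exact (hτ _).mpr (hn2.of_pow hn.ne')
      obtain ⟨N, hfin, hpN, hN⟩ := CommGroup.exists_isPGroup_quotient_notMem (p := p) hinf
      refine exists_surjective_not_isConj_of_hom hpN
        ((QuotientGroup.mk' N).comp (QuotientGroup.mk' τ)) fun g hg ↦ hN ?_
      refine (QuotientGroup.eq (a := (a : G ⧸ τ)) (b := (b : G ⧸ τ))).mp (Eq.trans ?_ hg)
      rw [map_mul, map_mul, map_inv, mul_inv_cancel_comm]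
      rfl
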